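/- For unital C*-algebras A and B and fixed n ≥ 1, the set of n-factorable u.c.p. maps A → B is convex, where a u.c.p. map θ is n-factorable if θ = ψ ∘ φ with φ : A → F a unital *-homomorphism, ψ : F → B a u.c.p. map, and F a finite-dimensional n-subhomogeneous C*-algebra. -/

import Mathlib

noncomputable section

/-- An element of a `*`-ring is positive if it is of the form `star b * b`.
(In a C*-algebra this is the usual positivity.) -/
def IsPosElem {A : Type*} [NonUnitalSemiring A] [StarRing A] (a : A) : Prop :=
  ∃ b, a = star b * b

/-- A linear map `φ : A → B` between `*`-algebras is `k`-positive if
`φ ⊗ id_{M_k} : M_k(A) → M_k(B)` (i.e. the entrywise application of `φ`)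
maps positive elements to positive elements. -/
def KPositive {A B : Type*} [NonUnitalRing A] [StarRing A] [Module ℂ A]
    [NonUnitalRing B] [StarRing B] [Module ℂ B] (k : ℕ) (φ : A →ₗ[ℂ] B) : Prop :=
  ∀ x : Matrix (Fin k) (Fin k) A, IsPosElem x → IsPosElem (x.map φ)

/-- A linear map is completely positive if it is `k`-positive for all `k`. -/
def CompletelyPositive {A B : Type*} [NonUnitalRing A] [StarRing A] [Module ℂ A]
    [NonUnitalRing B] [StarRing B] [Module ℂ B] (φ : A →ₗ[ℂ] B) : Prop :=
  ∀ k : ℕ, KPositive k φ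
def IsIrreducibleRep {A : Type*} [NonUnitalNonAssocSemiring A] [DistribMulAction ℂ A] [Star A]
    {H : Type*} [NormedAddCommGroup H] [InnerProductSpace ℂ H] [CompleteSpace H]
    (π : A →⋆ₙₐ[ℂ] (H →L[ℂ] H)) : Prop :=
  (∃ a, π a ≠ 0) ∧
    ∀ S : Submodule ℂ H, IsClosed (S : Set H) →
      (∀ a : A, ∀ v ∈ S, π a v ∈ S) → S = ⊥ ∨ S = ⊤

/-- A `*`-algebra is `n`-subhomogeneous if all its irreducible representations (on complex
Hilbert spaces) have dimension at most `n`. -/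
def IsSubhomogeneous (n : ℕ) (A : Type*) [NonUnitalNonAssocSemiring A]
    [DistribMulAction ℂ A] [Star A] : Prop :=
  ∀ (H : Type) [NormedAddCommGroup H] [InnerProductSpace ℂ H] [CompleteSpace H]
    (π : A →⋆ₙₐ[ℂ] (H →L[ℂ] H)), IsIrreducibleRep π → Module.rank ℂ H ≤ n

/-- A u.c.p. map `θ : A → B` between unital C*-algebras is `n`-factorable if it factors as
`θ = ψ ∘ φ` where `φ : A → F` is a unital `*`-homomorphism, `ψ : F → B` is a u.c.p. map
and `F` is a finite-dimensional `n`-subhomogeneous C*-algebra. -/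
def NFactorable (n : ℕ) {A B : Type} [CStarAlgebra A] [CStarAlgebra B]
    (θ : A →ₗ[ℂ] B) : Prop :=
  ∃ (F : Type) (_ : CStarAlgebra F) (_ : FiniteDimensional ℂ F),
    IsSubhomogeneous n F ∧
      ∃ (φ : A →⋆ₐ[ℂ] F) (ψ : F →ₗ[ℂ] B),
        ψ 1 = 1 ∧ CompletelyPositive ψ ∧ θ = ψ ∘ₗ φ.toLinearMap

/-- A nonnegative combination of positive elements of a C*-algebra is positive. -/
theorem IsPosElem.smul_add_smul {B : Type*} [CStarAlgebra B] {x y : B}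
    (hx : IsPosElem x) (hy : IsPosElem y) {s t : ℝ} (hs : 0 ≤ s) (ht : 0 ≤ t) :
    IsPosElem ((s : ℂ) • x + (t : ℂ) • y) := by
  let _ : PartialOrder B := CStarAlgebra.spectralOrder B
  have : StarOrderedRing B := CStarAlgebra.spectralOrderedRing B
  obtain ⟨b, rfl⟩ := hx
  obtain ⟨c, rfl⟩ := hy
  rw [Complex.coe_smul, Complex.coe_smul]
  exact CStarAlgebra.nonneg_iff_eq_star_mul_self.mp <|
    add_nonneg (smul_nonneg hs (star_mul_self_nonneg b)) (smul_nonneg ht (star_mul_self_nonneg c))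

/-- A nonnegative combination of positive elements of a matrix algebra over a C*-algebra is
positive. -/
theorem IsPosElem.matrix_smul_add_smul {B : Type*} [CStarAlgebra B] {k : ℕ}
    {x y : Matrix (Fin k) (Fin k) B} (hx : IsPosElem x) (hy : IsPosElem y)
    {s t : ℝ} (hs : 0 ≤ s) (ht : 0 ≤ t) :
    IsPosElem ((s : ℂ) • x + (t : ℂ) • y) := by
  let _ : PartialOrder B := CStarAlgebra.spectralOrder B
  have : StarOrderedRing B := CStarAlgebra.spectralOrderedRing B
  obtain ⟨b, rfl⟩ := hx
  obtain ⟨c, rfl⟩ := hy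
  obtain ⟨d, hd⟩ := IsPosElem.smul_add_smul (B := CStarMatrix (Fin k) (Fin k) B)
    ⟨CStarMatrix.ofMatrix b, rfl⟩ ⟨CStarMatrix.ofMatrix c, rfl⟩ hs ht
  exact ⟨CStarMatrix.ofMatrix.symm d, hd⟩

/-- The image of a positive element under a `*`-homomorphism, applied entrywise, is positive. -/
theorem IsPosElem.matrix_map {A B : Type*} [Ring A] [StarRing A] [Algebra ℂ A]
    [Ring B] [StarRing B] [Algebra ℂ B] {k : ℕ} {x : Matrix (Fin k) (Fin k) A}
    (hx : IsPosElem x) (f : A →⋆ₐ[ℂ] B) : IsPosElem (x.map f) := by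
  obtain ⟨b, rfl⟩ := hx
  refine ⟨b.map f, ?_⟩
  rw [Matrix.map_mul, Matrix.star_eq_conjTranspose, Matrix.star_eq_conjTranspose,
    Matrix.conjTranspose_map]
  exact fun a => map_star f a

/-- An irreducible representation restricted along `f` is irreducible if the restriction has the
same range. -/
theorem IsIrreducibleRep.comp_of_range {A C H : Type*} [NonUnitalNonAssocSemiring A]
    [DistribMulAction ℂ A] [Star A] [NonUnitalNonAssocSemiring C]
    [DistribMulAction ℂ C] [Star C]
    [NormedAddCommGroup H] [InnerProductSpace ℂ H] [CompleteSpace H]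
    {π : A →⋆ₙₐ[ℂ] (H →L[ℂ] H)} (hπ : IsIrreducibleRep π) (f : C →⋆ₙₐ[ℂ] A)
    (hf : ∀ a, ∃ c, π (f c) = π a) : IsIrreducibleRep (π.comp f) := by
  refine ⟨?_, fun S hS hinv => hπ.2 S hS fun a v hv => ?_⟩
  · obtain ⟨a, ha⟩ := hπ.1
    obtain ⟨c, hc⟩ := hf a
    exact ⟨c, by simpa [hc] using ha⟩
  · obtain ⟨c, hc⟩ := hf a
    rw [← hc]
    exact hinv c v hv

/-- A product of unital `n`-subhomogeneous algebras is `n`-subhomogeneous. -/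
theorem IsSubhomogeneous.prod {n : ℕ} {A C : Type*} [Ring A] [StarRing A] [Algebra ℂ A]
    [Ring C] [StarRing C] [Algebra ℂ C]
    (hA : IsSubhomogeneous n A) (hC : IsSubhomogeneous n C) : IsSubhomogeneous n (A × C) := by
  intro H _ _ _ π hπ
  let P : H →L[ℂ] H := π (1, 0)
  have hP : ∀ v, P (P v) = P v := fun v => by
    simpa [P] using (DFunLike.congr_fun (map_mul π (1, 0) (1, 0)) v).symm
  have hcomm : ∀ a v, P (π a v) = π a (P v) := fun a v => by
    have h : π (1, 0) * π a = π a * π (1, 0) := by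
      rw [← map_mul, ← map_mul]
      congr 1
      ext <;> simp
    exact DFunLike.congr_fun h v
  have hsplit : ∀ a : A × C, π (a.1, 0) = π a * P := fun a => by
    rw [← map_mul]
    congr 1
    ext <;> simp
  rcases hπ.2 (LinearMap.eqLocus P.toLinearMap LinearMap.id)
      (isClosed_eq P.continuous continuous_id)
      (fun a v hv => (hcomm a v).trans (congrArg (π a) hv)) with h | h
  · have hP0 : P = 0 := by
      ext v
      have hv : P v ∈ LinearMap.eqLocus P.toLinearMap LinearMap.id := hP v
      rw [h] at hv
      exact hv
    refine hC H _ (hπ.comp_of_range (NonUnitalStarAlgHom.inr ℂ A C) fun a => ⟨a.2, ?_⟩)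
    have hz : π (a.1, 0) = 0 := by rw [hsplit, hP0, mul_zero]
    have ha : π a = π (a.1, 0) + π (0, a.2) := by
      rw [← map_add]
      congr 1
      ext <;> simp
    rw [ha, hz, zero_add]
    rfl
  · have hP1 : P = 1 := by
      ext v
      have hv : v ∈ LinearMap.eqLocus P.toLinearMap LinearMap.id := h ▸ Submodule.mem_top
      exact hv
    refine hA H _ (hπ.comp_of_range (NonUnitalStarAlgHom.inl ℂ A C) fun a => ⟨a.1, ?_⟩)
    have := hsplit a
    rw [hP1, mul_one] at this
    exact this

/-- For unital C*-algebras `A`, `B` and `n ≥ 1`, the set of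
`n`-factorable u.c.p. maps `A → B` is convex: a convex combination of two `n`-factorable
maps is again `n`-factorable. -/
theorem stmt12 (n : ℕ) (hn : 1 ≤ n) (A B : Type) [CStarAlgebra A] [CStarAlgebra B]
    (θ₀ θ₁ : A →ₗ[ℂ] B)
    (h₀u : θ₀ 1 = 1) (h₀cp : CompletelyPositive θ₀) (h₀ : NFactorable n θ₀)
    (h₁u : θ₁ 1 = 1) (h₁cp : CompletelyPositive θ₁) (h₁ : NFactorable n θ₁)
    (t : ℝ) (ht0 : 0 ≤ t) (ht1 : t ≤ 1) :
    NFactorable n (((t : ℂ)) • θ₀ + ((1 - t : ℝ) : ℂ) • θ₁) := by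
  obtain ⟨F₀, _, _, hF₀, φ₀, ψ₀, hψ₀, hcp₀, rfl⟩ := h₀
  obtain ⟨F₁, _, _, hF₁, φ₁, ψ₁, hψ₁, hcp₁, rfl⟩ := h₁
  refine ⟨F₀ × F₁, inferInstance, inferInstance, hF₀.prod hF₁, φ₀.prod φ₁,
    (t : ℂ) • ψ₀ ∘ₗ LinearMap.fst ℂ F₀ F₁ + ((1 - t : ℝ) : ℂ) • ψ₁ ∘ₗ LinearMap.snd ℂ F₀ F₁,
    ?_, fun k x hx => ?_, ?_⟩
  · simp [hψ₀, hψ₁, sub_smul]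
  · exact IsPosElem.matrix_smul_add_smul (hcp₀ k _ (hx.matrix_map (StarAlgHom.fst ℂ F₀ F₁)))
      (hcp₁ k _ (hx.matrix_map (StarAlgHom.snd ℂ F₀ F₁))) ht0 (sub_nonneg.mpr ht1)
  · ext a
    rfl

end
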